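/- Let (G, <) be an ordered group and S a finite subset of G with |S| = k ≥ 2 such that |S²| ≤ 3k - 3. Then the subgroup ⟨S⟩ generated by S is abelian. -/

import Mathlib

open Pointwise

section aux
variable {G : Type*} [Group G] [LinearOrder G]
    [CovariantClass G G (· * ·) (· < ·)]
    [CovariantClass G G (Function.swap (· * ·)) (· < ·)]

lemma aux_l (a : G) {b c : G} (h : b < c) : a * b < a * c :=
  CovariantClass.elim (μ := (· * · : G → G → G)) (r := (· < ·)) a h

lemma aux_r (a : G) {b c : G} (h : b < c) : b * a < c * a :=
  CovariantClass.elim (μ := Function.swap (· * · : G → G → G)) (r := (· < ·)) a h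

lemma aux_le_l (a : G) {b c : G} (h : b ≤ c) : a * b ≤ a * c := by
  rcases h.lt_or_eq with h | h
  · exact (aux_l a h).le
  · rw [h]

lemma aux_le_r (a : G) {b c : G} (h : b ≤ c) : b * a ≤ c * a := by
  rcases h.lt_or_eq with h | h
  · exact (aux_r a h).le
  · rw [h]

/-- The square of a nonempty finite set has at least `2|T| - 1` elements. -/
lemma aux_card (T : Finset G) (hT : T.Nonempty) : 2 * T.card ≤ (T * T).card + 1 := by
  haveI : MulLeftMono G := ⟨fun a _ _ h => aux_le_l a h⟩
  haveI : MulRightMono G := ⟨fun a _ _ h => aux_le_r a h⟩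
  have := cauchy_davenport_mul_of_linearOrder_isCancelMul hT hT
  omega

/-- If left and right translates of `T` by `y` agree, `y` commutes with `T`. -/
lemma aux_comm (y : G) (T : Finset G)
    (h : T.image (fun t => y * t) = T.image (fun t => t * y)) :
    ∀ t ∈ T, y * t = t * y := by
  induction T using Finset.induction_on_max with
  | empty => simp
  | insert a T ha ih =>
    have haT : a ∉ T := fun h => lt_irrefl _ (ha a h)
    have hmax : y * a = a * y := by
      have h1 : y * a ∈ (insert a T).image (fun t => t * y) := by
        rw [← h]; exact Finset.mem_image_of_mem _ (Finset.mem_insert_self _ _)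
      have h2 : a * y ∈ (insert a T).image (fun t => y * t) := by
        rw [h]
        exact Finset.mem_image_of_mem (fun t => t * y) (Finset.mem_insert_self _ _)
      have hle : ∀ s ∈ insert a T, s ≤ a := by
        intro s hs
        rcases Finset.mem_insert.1 hs with rfl | hs
        · exact le_rfl
        · exact (ha s hs).le
      obtain ⟨s, hs, hs'⟩ := Finset.mem_image.1 h1
      obtain ⟨r, hr, hr'⟩ := Finset.mem_image.1 h2
      apply le_antisymm
      · rw [← hs']; exact aux_le_r y (hle s hs)
      · rw [← hr']; exact aux_le_l y (hle r hr)
    have hT : T.image (fun t => y * t) = T.image (fun t => t * y) := by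
      rw [Finset.image_insert, Finset.image_insert] at h
      have n1 : y * a ∉ T.image (fun t => y * t) := by simpa using haT
      have n2 : a * y ∉ T.image (fun t => t * y) := by simpa using haT
      rw [← Finset.erase_insert n1, ← Finset.erase_insert n2, h, hmax]
    intro t ht
    rcases Finset.mem_insert.1 ht with rfl | ht
    · exact hmax
    · exact ih hT t ht

/-- The case where `T` is commutative. -/
lemma aux_A (y : G) (T : Finset G) (hT : T.Nonempty) (hy : ∀ t ∈ T, t < y)
    (hc : ∀ a ∈ T, ∀ b ∈ T, Commute a b)
    (hd : (insert y T * insert y T).card ≤ 3 * T.card) : ∀ t ∈ T, Commute y t := by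
  by_contra hcon
  push Not at hcon
  obtain ⟨t₀, ht₀, hnc⟩ := hcon
  set L := T.image (fun t => y * t) with hL
  set R := T.image (fun t => t * y) with hR
  have hLc : L.card = T.card :=
    Finset.card_image_of_injective _ (fun a b h => mul_left_cancel h)
  have hRc : R.card = T.card :=
    Finset.card_image_of_injective _ (fun a b h => mul_right_cancel h)
  have hne : L ≠ R := fun h => hnc (aux_comm y T h t₀ ht₀)
  have hU : T.card + 1 ≤ (L ∪ R).card := by
    by_contra hlt
    have h1 : L = L ∪ R := Finset.eq_of_subset_of_card_le Finset.subset_union_left (by omega)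
    have h2 : R = L ∪ R := Finset.eq_of_subset_of_card_le Finset.subset_union_right (by omega)
    exact hne (h1.trans h2.symm)
  have hTd : Disjoint (T * T) (L ∪ R) := by
    rw [Finset.disjoint_left]
    intro z hz hz'
    obtain ⟨a, ha, b, hb, rfl⟩ := Finset.mem_mul.1 hz
    apply hnc
    have hab : Commute (a * b) t₀ := (hc a ha t₀ ht₀).mul_left (hc b hb t₀ ht₀)
    rcases Finset.mem_union.1 hz' with h | h
    · obtain ⟨t, ht, h⟩ := Finset.mem_image.1 h
      have : y = a * b * t⁻¹ := by rw [← h]; group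
      rw [this]
      exact hab.mul_left (hc t ht t₀ ht₀).inv_left
    · obtain ⟨t, ht, h⟩ := Finset.mem_image.1 h
      have : y = t⁻¹ * (a * b) := by rw [← h]; group
      rw [this]
      exact (hc t ht t₀ ht₀).inv_left.mul_left hab
  have hyy : y * y ∉ (T * T) ∪ (L ∪ R) := by
    intro h
    rcases Finset.mem_union.1 h with h | h
    · obtain ⟨a, ha, b, hb, h⟩ := Finset.mem_mul.1 h
      exact (((aux_l a (hy b hb)).trans (aux_r y (hy a ha)))).ne h
    · rcases Finset.mem_union.1 h with h | h
      · obtain ⟨t, ht, h⟩ := Finset.mem_image.1 h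
        exact (aux_l y (hy t ht)).ne h
      · obtain ⟨t, ht, h⟩ := Finset.mem_image.1 h
        exact (aux_r y (hy t ht)).ne h
  have hsub : insert (y * y) ((T * T) ∪ (L ∪ R)) ⊆ insert y T * insert y T := by
    have hyS := Finset.mem_insert_self y T
    intro z hz
    rcases Finset.mem_insert.1 hz with rfl | hz
    · exact Finset.mul_mem_mul hyS hyS
    rcases Finset.mem_union.1 hz with h | h
    · exact Finset.mul_subset_mul (Finset.subset_insert _ _) (Finset.subset_insert _ _) h
    rcases Finset.mem_union.1 h with h | h
    · obtain ⟨t, ht, rfl⟩ := Finset.mem_image.1 h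
      exact Finset.mul_mem_mul hyS (Finset.mem_insert_of_mem ht)
    · obtain ⟨t, ht, rfl⟩ := Finset.mem_image.1 h
      exact Finset.mul_mem_mul (Finset.mem_insert_of_mem ht) hyS
  have h1 := Finset.card_le_card hsub
  rw [Finset.card_insert_of_notMem hyy, Finset.card_union_of_disjoint hTd] at h1
  have := aux_card T hT
  omega

/-- The case where `S²` has at most two elements outside `T²`. -/
lemma aux_B (y : G) (T : Finset G) (hT : T.Nonempty) (hy : ∀ t ∈ T, t < y)
    (hd : (insert y T * insert y T).card ≤ (T * T).card + 2) :
    ∀ a ∈ insert y T, ∀ b ∈ insert y T, Commute a b := by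
  obtain ⟨m, hm, hmax⟩ := T.exists_max_image id hT
  simp only [id] at hmax
  have hyS := Finset.mem_insert_self y T
  have hmS : m ∈ insert y T := Finset.mem_insert_of_mem hm
  have hTT : ∀ z ∈ T * T, z ≤ m * m := by
    intro z hz
    obtain ⟨a, ha, b, hb, rfl⟩ := Finset.mem_mul.1 hz
    exact (aux_le_l a (hmax b hb)).trans (aux_le_r m (hmax a ha))
  have hmy := hy m hm
  have key : ∀ z ∈ insert y T * insert y T, z ≠ y * y → z ≠ y * m → z ∈ T * T := by
    intro z hz h1 h2
    by_contra hz'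
    have n1 : y * m ∉ T * T := fun h => absurd (hTT _ h) (not_le.2 (aux_r m hmy))
    have n2 : y * y ∉ insert (y * m) (T * T) := by
      intro h
      rcases Finset.mem_insert.1 h with h | h
      · exact (aux_l y hmy).ne' h
      · exact absurd (hTT _ h) (not_le.2 ((aux_r m hmy).trans (aux_l y hmy)))
    have n3 : z ∉ insert (y * y) (insert (y * m) (T * T)) := by
      simp only [Finset.mem_insert, not_or]
      exact ⟨h1, h2, hz'⟩
    have hsub : insert z (insert (y * y) (insert (y * m) (T * T))) ⊆
        insert y T * insert y T := by
      intro w hw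
      rcases Finset.mem_insert.1 hw with rfl | hw
      · exact hz
      rcases Finset.mem_insert.1 hw with rfl | hw
      · exact Finset.mul_mem_mul hyS hyS
      rcases Finset.mem_insert.1 hw with rfl | hw
      · exact Finset.mul_mem_mul hyS hmS
      · exact Finset.mul_subset_mul (Finset.subset_insert _ _) (Finset.subset_insert _ _) hw
    have := Finset.card_le_card hsub
    rw [Finset.card_insert_of_notMem n3, Finset.card_insert_of_notMem n2,
      Finset.card_insert_of_notMem n1] at this
    omega
  have hcomm : y * m = m * y := by
    by_contra hne
    have := key (m * y) (Finset.mul_mem_mul hmS hyS) (aux_r y hmy).ne (Ne.symm hne)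
    exact absurd (hTT _ this) (not_le.2 (aux_l m hmy))
  have hall : ∀ x ∈ insert y T, ∀ s ∈ insert y T, x < s → Commute x s := by
    by_contra hcon
    push Not at hcon
    obtain ⟨x₀, hx₀, s₀, hs₀, hlt₀, hn₀⟩ := hcon
    let _ := Classical.decPred (fun x => ∃ s ∈ insert y T, x < s ∧ ¬ Commute x s)
    let B := (insert y T).filter (fun x => ∃ s ∈ insert y T, x < s ∧ ¬ Commute x s)
    obtain ⟨x, hx, hxmax⟩ := B.exists_max_image id
      ⟨x₀, Finset.mem_filter.2 ⟨hx₀, s₀, hs₀, hlt₀, hn₀⟩⟩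
    obtain ⟨hxS, s, hs, hxs, hns⟩ := Finset.mem_filter.1 hx
    have hA : ∀ a ∈ insert y T, ∀ b ∈ insert y T, x < a → x < b → Commute a b := by
      have hw : ∀ a ∈ insert y T, ∀ b ∈ insert y T, x < a → a < b → Commute a b := by
        intro a ha b hb hxa hab
        by_contra hn
        exact absurd (hxmax a (Finset.mem_filter.2 ⟨ha, b, hb, hab, hn⟩)) (not_le.2 hxa)
      intro a ha b hb hxa hxb
      rcases lt_trichotomy a b with h | h | h
      · exact hw a ha b hb hxa h
      · rw [h]
      · exact (hw b hb a ha hxb h).symm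
    have hxy : x < y := by
      rcases Finset.mem_insert.1 hs with rfl | hs
      · exact hxs
      · exact hxs.trans (hy s hs)
    have hxm : x < m := by
      rcases Finset.mem_insert.1 hs with rfl | hs
      · rcases Finset.mem_insert.1 hxS with rfl | hxT
        · exact absurd hxs (lt_irrefl _)
        · refine lt_of_le_of_ne (hmax x hxT) ?_
          rintro rfl
          exact hns hcomm.symm
      · exact hxs.trans_le (hmax s hs)
    have h1 : y * x ∈ T * T := key _ (Finset.mul_mem_mul hyS hxS)
      (aux_l y hxy).ne (aux_l y hxm).ne
    have h2 : x * y ∈ T * T := key _ (Finset.mul_mem_mul hxS hyS)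
      (aux_r y hxy).ne (by rw [hcomm]; exact (aux_r y hxm).ne)
    obtain ⟨a, ha, b, hb, hab⟩ := Finset.mem_mul.1 h1
    obtain ⟨c, hc, d, hd', hcd⟩ := Finset.mem_mul.1 h2
    have haS := Finset.mem_insert_of_mem (b := y) ha
    have hbS := Finset.mem_insert_of_mem (b := y) hb
    have hcS := Finset.mem_insert_of_mem (b := y) hc
    have hdS := Finset.mem_insert_of_mem (b := y) hd'
    have hxb : x < b := by
      by_contra h
      exact absurd hab ((aux_le_l a (not_lt.1 h)).trans_lt (aux_r x (hy a ha))).ne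
    have hxc : x < c := by
      by_contra h
      exact absurd hcd ((aux_le_r d (not_lt.1 h)).trans_lt (aux_l x (hy d hd'))).ne
    have hax : a ≤ x := by
      by_contra h
      apply hns
      have : x = y⁻¹ * (a * b) := by rw [hab]; group
      rw [this]
      exact (hA y hyS s hs hxy hxs).inv_left.mul_left
        ((hA a haS s hs (not_le.1 h) hxs).mul_left (hA b hbS s hs hxb hxs))
    have hdx : d ≤ x := by
      by_contra h
      apply hns
      have : x = (c * d) * y⁻¹ := by rw [hcd]; group
      rw [this]
      exact ((hA c hcS s hs hxc hxs).mul_left (hA d hdS s hs (not_le.1 h) hxs)).mul_left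
        (hA y hyS s hs hxy hxs).inv_left
    have l1 : y * x < x * y := by
      rw [← hab]; exact (aux_le_r b hax).trans_lt (aux_l x (hy b hb))
    have l2 : x * y < y * x := by
      rw [← hcd]; exact (aux_le_l c hdx).trans_lt (aux_r x (hy c hc))
    exact lt_asymm l1 l2
  intro a ha b hb
  rcases lt_trichotomy a b with h | h | h
  · exact hall a ha b hb h
  · rw [h]
  · exact (hall b hb a ha h).symm

lemma aux_main (S : Finset G) :
    (S * S).card + 3 ≤ 3 * S.card → ∀ a ∈ S, ∀ b ∈ S, Commute a b := by
  induction S using Finset.induction_on_max with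
  | empty => simp
  | insert y T hy ih =>
    intro hd
    have hyT : y ∉ T := fun h => lt_irrefl _ (hy y h)
    rw [Finset.card_insert_of_notMem hyT] at hd
    rcases T.eq_empty_or_nonempty with rfl | hT
    · simp at hd
    by_cases hc : ∀ a ∈ T, ∀ b ∈ T, Commute a b
    · have h := aux_A y T hT hy hc (by omega)
      intro a ha b hb
      rcases Finset.mem_insert.1 ha with rfl | ha1 <;> rcases Finset.mem_insert.1 hb with rfl | hb1
      · exact Commute.refl _
      · exact h b hb1
      · exact (h a ha1).symm
      · exact hc a ha1 b hb1
    · have : ¬ ((T * T).card + 3 ≤ 3 * T.card) := fun h => hc (ih h)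
      exact aux_B y T hT hy (by omega)

end aux

/-- Theorem 1.3 of [7]: in an ordered group, a finite subset `S` with `|S| = k ≥ 2`
and `|S²| ≤ 3k - 3` generates an abelian subgroup. -/
theorem stmt_19 {G : Type*} [Group G] [LinearOrder G]
    [CovariantClass G G (· * ·) (· < ·)]
    [CovariantClass G G (Function.swap (· * ·)) (· < ·)]
    (S : Finset G) (k : ℕ) (hcard : S.card = k) (hk : 2 ≤ k)
    (hd : (S * S).card ≤ 3 * k - 3) :
    ∀ x ∈ Subgroup.closure (S : Set G), ∀ y ∈ Subgroup.closure (S : Set G),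
      x * y = y * x := by
  have hc := aux_main S (by omega)
  have h1 : ∀ b ∈ S, ∀ x ∈ Subgroup.closure (S : Set G), Commute x b := by
    intro b hb x hx
    induction hx using Subgroup.closure_induction with
    | mem a ha => exact hc a ha b hb
    | one => exact Commute.one_left _
    | mul a c _ _ h h' => exact h.mul_left h'
    | inv a _ h => exact h.inv_left
  intro x hx y hy
  change Commute x y
  induction hy using Subgroup.closure_induction with
  | mem a ha => exact h1 a ha x hx
  | one => exact Commute.one_right _
  | mul a c _ _ h h' => exact h.mul_right h'
  | inv a _ h => exact h.inv_right
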